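/- arXiv:2510.20843 — 6 statements merged into one kernel-verified Lean document; each statement's English description precedes it below -/
import Mathlib

section
/- Let f : ℝ → ℝ be locally absolutely continuous, i.e., absolutely continuous on every compact interval [a,b] ⊆ ℝ. If the derivative f' (which exists almost everywhere) satisfies ∫_K |f'| dμ < ∞ for every Lebesgue measurable set K ⊆ ℝ of finite Lebesgue measure, then f is absolutely continuous on ℝ; conversely, if f is absolutely continuous on ℝ, then ∫_K |f'| dμ < ∞ for every Lebesgue measurable set K ⊆ ℝ of finite Lebesgue measure. (Theorem 1: f ∈ AC_loc(ℝ) with f' ∈ L¹_G(ℝ) if and only if f ∈ AC(ℝ).) -/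
open MeasureTheory Set Filter
open scoped ENNReal

/-- `f` is absolutely continuous on the set `I`: for every `ε > 0` there is `δ > 0` such that
for every finite collection of pairwise disjoint subintervals `(a i, b i)` of `I` with
`∑ (b i - a i) < δ` one has `∑ |f (b i) - f (a i)| < ε`. -/
def AbsolutelyContinuousOn (f : ℝ → ℝ) (I : Set ℝ) : Prop :=
  ∀ ε : ℝ, 0 < ε → ∃ δ : ℝ, 0 < δ ∧
    ∀ (n : ℕ) (a b : Fin n → ℝ),
      (∀ i, a i ∈ I ∧ b i ∈ I ∧ a i ≤ b i) →
      (Pairwise fun i j => Disjoint (Ioo (a i) (b i)) (Ioo (a j) (b j))) →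
      ∑ i, (b i - a i) < δ →
      ∑ i, |f (b i) - f (a i)| < ε

theorem AbsolutelyContinuousOn.absolutelyContinuousOnInterval {f : ℝ → ℝ} {a b : ℝ}
    (hf : AbsolutelyContinuousOn f (Icc a b)) (hab : a ≤ b) :
    AbsolutelyContinuousOnInterval f a b := by
  rw [absolutelyContinuousOnInterval_iff]
  intro ε hε
  obtain ⟨δ, hδ, h⟩ := hf ε hε
  refine ⟨δ, hδ, ?_⟩
  rintro ⟨n, I⟩ ⟨hmem, hdisj⟩ hsum
  simp only [uIcc_of_le hab, Finset.mem_range] at hmem hsum ⊢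
  have key := h n (fun i => min (I i).1 (I i).2) (fun i => max (I i).1 (I i).2) ?_ ?_ ?_
  · rw [← Fin.sum_univ_eq_sum_range (fun i => dist (f (I i).1) (f (I i).2))]
    refine lt_of_eq_of_lt (Finset.sum_congr rfl fun i _ => ?_) key
    rcases le_total (I i).1 (I i).2 with hi | hi
    · simp [hi, Real.dist_eq, abs_sub_comm]
    · simp [hi, Real.dist_eq]
  · intro i
    obtain ⟨h1, h2⟩ := hmem i i.2
    exact ⟨⟨le_min h1.1 h2.1, (min_le_left _ _).trans h1.2⟩,
      ⟨h1.1.trans (le_max_left _ _), max_le h1.2 h2.2⟩, min_le_max⟩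
  · intro i j hij
    have := hdisj (x := (i : ℕ)) (by simp) (y := (j : ℕ)) (by simp)
      (by simpa [Fin.ext_iff] using hij)
    exact Disjoint.mono Ioo_subset_Ioc_self Ioo_subset_Ioc_self this
  · rw [← Fin.sum_univ_eq_sum_range (fun i => dist (I i).1 (I i).2)] at hsum
    refine lt_of_eq_of_lt (Finset.sum_congr rfl fun i _ => ?_) hsum
    rw [Real.dist_eq, max_sub_min_eq_abs']

/-- A measurable subset of `Ioc c d` is approximated, for a finite measure, by finite disjoint
unions of intervals contained in `Ioc c d`. -/
theorem exists_iUnion_Ioc_measure_symmDiff_lt (μ : Measure ℝ) [IsFiniteMeasure μ] {S : Set ℝ}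
    (hS : MeasurableSet S) {c d : ℝ} (hcd : c ≤ d) (hSJ : S ⊆ Ioc c d) {ε : ℝ≥0∞} (hε : 0 < ε) :
    ∃ (n : ℕ) (a b : Fin n → ℝ), (∀ i, a i ≤ b i) ∧
      (Pairwise fun i j => Disjoint (Ioc (a i) (b i)) (Ioc (a j) (b j))) ∧
      (⋃ i, Ioc (a i) (b i)) ⊆ Ioc c d ∧
      μ (symmDiff (⋃ i, Ioc (a i) (b i)) S) < ε := by
  have hring := IsSetSemiring.Ioc (α := ℝ)
  have hgen : (inferInstance : MeasurableSpace ℝ) =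
      MeasurableSpace.generateFrom {s : Set ℝ | ∃ u v, u ≤ v ∧ s = Ioc u v} := by
    borelize ℝ
    convert! borel_eq_generateFrom_Ioc_le ℝ using 2
    grind only
  have hcover : ∃ D : Set (Set ℝ), D.Countable ∧ D ⊆ {s : Set ℝ | ∃ u v, u ≤ v ∧ s = Ioc u v} ∧
      μ (⋃₀ D)ᶜ = 0 := by
    refine ⟨range fun n : ℕ => Ioc (-(n : ℝ)) n, countable_range _, ?_, ?_⟩
    · rintro _ ⟨n, rfl⟩
      exact ⟨_, _, by simp, rfl⟩
    · have : ⋃₀ (range fun n : ℕ => Ioc (-(n : ℝ)) n) = univ := by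
        refine eq_univ_of_forall fun x => ?_
        obtain ⟨n, hn⟩ := exists_nat_gt |x|
        exact ⟨_, ⟨n, rfl⟩, (abs_lt.1 hn).1, (abs_lt.1 hn).2.le⟩
      simp [this]
  obtain ⟨t, ht, htS⟩ := exists_measure_symmDiff_lt_of_generateFrom_isSetSemiring (μ := μ) hring
    hcover hgen hS hε
  have ht' : t ∩ Ioc c d ∈ supClosure {s : Set ℝ | ∃ u v, u ≤ v ∧ s = Ioc u v} :=
    hring.isSetRing_supClosure.inter_mem ht (subset_supClosure ⟨c, d, hcd, rfl⟩)
  obtain ⟨P, hP⟩ := hring.mem_supClosure_iff.1 ht'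
  let e := P.parts.equivFin
  choose a b hab hI using fun i => hP (e.symm i).2
  have hU : ⋃ i, Ioc (a i) (b i) = t ∩ Ioc c d := by
    refine Eq.trans ?_ P.sup_parts
    rw [Finset.sup_id_set_eq_sUnion, sUnion_eq_iUnion]
    simp_rw [← hI]
    exact e.symm.surjective.iUnion_comp (fun s : P.parts => (s : Set ℝ))
  refine ⟨_, a, b, hab, fun i j hij => ?_, ?_, ?_⟩
  · simp only [← hI]
    exact P.disjoint (e.symm i).2 (e.symm j).2
      fun h => hij (e.symm.injective (Subtype.ext h))
  · rw [hU]
    exact inter_subset_right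
  · rw [hU]
    refine (measure_mono ?_).trans_lt htS
    intro x hx
    simp only [mem_symmDiff, mem_inter_iff] at hx ⊢
    have := @hSJ x
    tauto

theorem abs_setIntegral_deriv_le {f : ℝ → ℝ}
    (hf : ∀ a b : ℝ, a ≤ b → AbsolutelyContinuousOnInterval f a b) {δ : ℝ}
    (hδ : ∀ (n : ℕ) (a b : Fin n → ℝ), (∀ i, a i ≤ b i) →
      (Pairwise fun i j => Disjoint (Ioo (a i) (b i)) (Ioo (a j) (b j))) →
      ∑ i, (b i - a i) < δ → ∑ i, |f (b i) - f (a i)| < 1)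
    {c d : ℝ} (hcd : c ≤ d) {S : Set ℝ} (hS : MeasurableSet S) (hSJ : S ⊆ Ioc c d)
    (hSδ : volume S < ENNReal.ofReal δ) :
    |∫ x in S, deriv f x| ≤ 2 := by
  have hint : ∀ {a b : ℝ}, a ≤ b → IntegrableOn (deriv f) (Ioc a b) := fun hab =>
    (intervalIntegrable_iff_integrableOn_Ioc_of_le hab).1 (hf _ _ hab).intervalIntegrable_deriv
  have hJ := hint hcd
  let μ : Measure ℝ := volume.restrict (Ioc c d) +
    (volume.restrict (Ioc c d)).withDensity fun x => ‖deriv f x‖ₑ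
  have : IsFiniteMeasure ((volume.restrict (Ioc c d)).withDensity fun x => ‖deriv f x‖ₑ) :=
    isFiniteMeasure_withDensity hJ.2.ne
  obtain ⟨n, a, b, hab, hdisj, hTJ, hT⟩ := exists_iUnion_Ioc_measure_symmDiff_lt μ hS hcd hSJ
    (ε := min 1 (ENNReal.ofReal δ - volume S)) (lt_min one_pos (tsub_pos_of_lt hSδ))
  set T := ⋃ i, Ioc (a i) (b i)
  have hTm : MeasurableSet T := MeasurableSet.iUnion fun i => measurableSet_Ioc
  have hDJ : symmDiff T S ⊆ Ioc c d := symmDiff_le_sup.trans (union_subset hTJ hSJ)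
  have hμ : μ (symmDiff T S) = volume (symmDiff T S) + ∫⁻ x in symmDiff T S, ‖deriv f x‖ₑ := by
    simp only [μ, Measure.add_apply, withDensity_apply _ (hTm.symmDiff hS),
      Measure.restrict_restrict (hTm.symmDiff hS), Measure.restrict_apply (hTm.symmDiff hS),
      inter_eq_left.2 hDJ]
  rw [hμ, lt_min_iff] at hT
  have hvolT : volume T < ENNReal.ofReal δ := by
    calc volume T ≤ volume (symmDiff T S) + volume S := by
          refine (measure_mono ?_).trans (measure_union_le _ _)
          intro x hx
          simp only [mem_union, mem_symmDiff]
          tauto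
      _ < (ENNReal.ofReal δ - volume S) + volume S :=
          ENNReal.add_lt_add_right (hSδ.ne_top) (le_self_add.trans_lt hT.2)
      _ = ENNReal.ofReal δ := tsub_add_cancel_of_le hSδ.le
  have hlen : ∑ i, (b i - a i) < δ := by
    rw [measure_iUnion hdisj fun i => measurableSet_Ioc, tsum_fintype] at hvolT
    simp only [Real.volume_Ioc] at hvolT
    rw [← ENNReal.ofReal_sum_of_nonneg fun i _ => sub_nonneg.2 (hab i)] at hvolT
    exact (ENNReal.ofReal_lt_ofReal_iff_of_nonneg
      (Finset.sum_nonneg fun i _ => sub_nonneg.2 (hab i))).1 hvolT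
  have hintT : |∫ x in T, deriv f x| ≤ 1 := by
    rw [integral_iUnion_fintype (fun i => measurableSet_Ioc) hdisj fun i => hint (hab i)]
    refine (Finset.abs_sum_le_sum_abs _ _).trans ?_
    simp_rw [← intervalIntegral.integral_of_le (hab _), (hf _ _ (hab _)).integral_deriv_eq_sub]
    exact (hδ n a b hab (fun i j hij =>
      (hdisj hij).mono Ioo_subset_Ioc_self Ioo_subset_Ioc_self) hlen).le
  have hintD : ∫ x in symmDiff T S, ‖deriv f x‖ ≤ 1 := by
    rw [integral_norm_eq_lintegral_enorm (measurable_deriv f).aestronglyMeasurable]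
    exact ENNReal.toReal_le_of_le_ofReal zero_le_one
      (by simpa using (le_add_self.trans_lt hT.1).le)
  have hsub : |(∫ x in S, deriv f x) - ∫ x in T, deriv f x| ≤ 1 := by
    refine le_trans ?_ hintD
    rw [← integral_indicator hS, ← integral_indicator hTm,
      ← integral_sub ((hJ.mono_set hSJ).integrable_indicator hS)
        ((hJ.mono_set hTJ).integrable_indicator hTm), ← integral_indicator (hTm.symmDiff hS)]
    refine abs_integral_le_integral_abs.trans_eq (integral_congr_ae (.of_forall fun x => ?_))
    by_cases h1 : x ∈ S <;> by_cases h2 : x ∈ T <;> simp [h1, h2, mem_symmDiff, indicator]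
  rw [abs_le] at *
  constructor <;> linarith

theorem setLIntegral_enorm_deriv_le {f : ℝ → ℝ}
    (hf : ∀ a b : ℝ, a ≤ b → AbsolutelyContinuousOnInterval f a b) {δ : ℝ}
    (hδ : ∀ (n : ℕ) (a b : Fin n → ℝ), (∀ i, a i ≤ b i) →
      (Pairwise fun i j => Disjoint (Ioo (a i) (b i)) (Ioo (a j) (b j))) →
      ∑ i, (b i - a i) < δ → ∑ i, |f (b i) - f (a i)| < 1)
    {S : Set ℝ} (hS : MeasurableSet S) (hSδ : volume S < ENNReal.ofReal δ) :
    ∫⁻ x in S, ‖deriv f x‖ₑ ≤ 4 := by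
  have hbdd : ∀ n : ℕ, ∫⁻ x in S ∩ Ioc (-(n : ℝ)) n, ‖deriv f x‖ₑ ≤ 4 := by
    intro n
    have hn : -(n : ℝ) ≤ n := by simp
    set R := S ∩ Ioc (-(n : ℝ)) n with hR
    have hRm : MeasurableSet R := hS.inter measurableSet_Ioc
    have hint : IntegrableOn (deriv f) R :=
      ((intervalIntegrable_iff_integrableOn_Ioc_of_le hn).1
        (hf _ _ hn).intervalIntegrable_deriv).mono_set inter_subset_right
    have key : ∀ A : Set ℝ, MeasurableSet A → |∫ x in A ∩ R, deriv f x| ≤ 2 := fun A hA =>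
      abs_setIntegral_deriv_le hf hδ hn (hA.inter hRm)
        (inter_subset_right.trans inter_subset_right)
        ((measure_mono (inter_subset_right.trans inter_subset_left)).trans_lt hSδ)
    have hpos := measurableSet_le (measurable_const (a := (0 : ℝ))) (measurable_deriv f)
    have hneg := measurableSet_le (measurable_deriv f) (measurable_const (a := (0 : ℝ)))
    have hnorm : ∫ x in R, ‖deriv f x‖ ≤ 4 := by
      rw [integral_norm_eq_pos_sub_neg hint, Measure.restrict_restrict hpos,
        Measure.restrict_restrict hneg]
      linarith [(abs_le.1 (key _ hpos)).2, (abs_le.1 (key _ hneg)).1]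
    rw [← ofReal_integral_norm_eq_lintegral_enorm hint]
    exact (ENNReal.ofReal_le_ofReal hnorm).trans_eq (by norm_num)
  have hU : S = ⋃ n : ℕ, S ∩ Ioc (-(n : ℝ)) n := by
    refine subset_antisymm (fun x hx => ?_) (iUnion_subset fun n => inter_subset_left)
    obtain ⟨n, hn⟩ := exists_nat_gt |x|
    exact mem_iUnion.2 ⟨n, hx, (abs_lt.1 hn).1, (abs_lt.1 hn).2.le⟩
  rw [hU, setLIntegral_iUnion_of_directed]
  · exact iSup_le hbdd
  · refine Monotone.directed_le fun m n hmn => inter_subset_inter_right _ ?_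
    have : (m : ℝ) ≤ n := by exact_mod_cast hmn
    exact Ioc_subset_Ioc (neg_le_neg this) this

/-- If `g` has finite integral over every measurable set of finite measure, then its integral
over a set tends to zero with the measure of the set. -/
theorem exists_pos_setLIntegral_lt_of_forall_lt_top {α : Type*} [MeasurableSpace α] {μ : Measure α}
    {g : α → ℝ≥0∞}
    (hg : ∀ K : Set α, MeasurableSet K → μ K < ⊤ → ∫⁻ x in K, g x ∂μ < ⊤)
    {ε : ℝ≥0∞} (hε : ε ≠ 0) :
    ∃ δ : ℝ≥0∞, 0 < δ ∧ ∀ s, MeasurableSet s → μ s < δ → ∫⁻ x in s, g x ∂μ < ε := by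
  by_contra! H
  obtain ⟨r, hr0, hr⟩ := ENNReal.exists_pos_sum_of_countable' one_ne_zero ℕ
  choose s hsm hs hsε using fun n => H (r n) (hr0 n)
  have hK : μ (⋃ n, s n) < ⊤ :=
    ((measure_iUnion_le s).trans (ENNReal.tsum_le_tsum fun n => (hs n).le)).trans_lt
      (hr.trans ENNReal.one_lt_top)
  obtain ⟨δ, hδ, h⟩ := exists_pos_setLIntegral_lt_of_measure_lt
    (hg _ (MeasurableSet.iUnion hsm) hK).ne hε
  obtain ⟨n, hn⟩ := ((ENNReal.tendsto_atTop_zero_of_tsum_ne_top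
    (hr.trans ENNReal.one_lt_top).ne).eventually (gt_mem_nhds hδ)).exists
  refine (hsε n).not_gt ?_
  have := h (s n) ((Measure.restrict_apply_le _ _).trans_lt ((hs n).trans hn))
  rwa [Measure.restrict_restrict (hsm n), inter_eq_left.2 (subset_iUnion s n)] at this

/-- Theorem 1: if `f` is locally absolutely continuous on `ℝ`, then `f' ∈ L¹_G(ℝ)`
(i.e. `∫_K |f'| < ∞` for every measurable set `K` of finite measure) iff `f ∈ AC(ℝ)`. -/
theorem theorem1
    (f : ℝ → ℝ)
    (hloc : ∀ a b : ℝ, AbsolutelyContinuousOn f (Icc a b)) :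
    (∀ K : Set ℝ, MeasurableSet K → volume K < ⊤ →
        ∫⁻ x in K, ‖deriv f x‖₊ ∂volume < ⊤) ↔
      AbsolutelyContinuousOn f univ := by
  have hf : ∀ a b : ℝ, a ≤ b → AbsolutelyContinuousOnInterval f a b := fun a b hab =>
    (hloc a b).absolutelyContinuousOnInterval hab
  have hint : ∀ {a b : ℝ}, a ≤ b → IntegrableOn (deriv f) (Ioc a b) := fun hab =>
    (intervalIntegrable_iff_integrableOn_Ioc_of_le hab).1 (hf _ _ hab).intervalIntegrable_deriv
  constructor
  · intro hK ε hε
    obtain ⟨δ, hδ0, hδ⟩ := exists_pos_setLIntegral_lt_of_forall_lt_top hK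
      (ENNReal.ofReal_pos.2 hε).ne'
    obtain ⟨η, hη0, hηδ⟩ := ENNReal.lt_iff_exists_nnreal_btwn.1 hδ0
    refine ⟨η, by exact_mod_cast hη0, fun n a b hab hdisj hsum => ?_⟩
    have hab' : ∀ i, a i ≤ b i := fun i => (hab i).2.2
    have hvol : volume (⋃ i, Ioo (a i) (b i)) < δ := by
      rw [measure_iUnion hdisj fun i => measurableSet_Ioo, tsum_fintype]
      simp only [Real.volume_Ioo]
      rw [← ENNReal.ofReal_sum_of_nonneg fun i _ => sub_nonneg.2 (hab' i)]
      refine lt_of_le_of_lt ?_ hηδ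
      rw [← ENNReal.ofReal_coe_nnreal]
      exact ENNReal.ofReal_le_ofReal hsum.le
    have hlt := hδ _ (MeasurableSet.iUnion fun i => measurableSet_Ioo) hvol
    rw [lintegral_iUnion (fun i => measurableSet_Ioo) hdisj, tsum_fintype] at hlt
    refine (ENNReal.ofReal_lt_ofReal_iff hε).1 (lt_of_le_of_lt ?_ hlt)
    rw [ENNReal.ofReal_sum_of_nonneg fun i _ => abs_nonneg _]
    refine Finset.sum_le_sum fun i _ => ?_
    rw [← (hf _ _ (hab' i)).integral_deriv_eq_sub, intervalIntegral.integral_of_le (hab' i),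
      ← Real.norm_eq_abs, ofReal_norm, setLIntegral_congr Ioo_ae_eq_Ioc]
    exact enorm_integral_le_lintegral_enorm _
  · intro hac K hKm hK
    obtain ⟨δ, hδ0, hδ⟩ := hac 1 one_pos
    have htend : Tendsto (fun n : ℕ => volume (K \ Ioc (-(n : ℝ)) n)) atTop (nhds 0) := by
      have hempty : ⋂ n : ℕ, K \ Ioc (-(n : ℝ)) n = ∅ := by
        refine eq_empty_of_forall_notMem fun x hx => ?_
        obtain ⟨n, hn⟩ := exists_nat_gt |x|
        exact (mem_iInter.1 hx n).2 ⟨(abs_lt.1 hn).1, (abs_lt.1 hn).2.le⟩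
      rw [← measure_empty (μ := (volume : Measure ℝ)), ← hempty]
      refine tendsto_measure_iInter_atTop
        (fun n => (hKm.diff measurableSet_Ioc).nullMeasurableSet) (fun m n hmn => ?_)
        ⟨0, ((measure_mono sdiff_subset).trans_lt hK).ne⟩
      have : (m : ℝ) ≤ n := by exact_mod_cast hmn
      exact sdiff_subset_sdiff_right (Ioc_subset_Ioc (neg_le_neg this) this)
    obtain ⟨n, hn⟩ := (htend.eventually (gt_mem_nhds (ENNReal.ofReal_pos.2 hδ0))).exists
    have htail : ∫⁻ x in K \ Ioc (-(n : ℝ)) n, ‖deriv f x‖ₑ ≤ 4 :=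
      setLIntegral_enorm_deriv_le hf
        (fun m a b hab => hδ m a b fun i => ⟨mem_univ _, mem_univ _, hab i⟩)
        (hKm.diff measurableSet_Ioc) hn
    have hcore : ∫⁻ x in Ioc (-(n : ℝ)) n, ‖deriv f x‖ₑ < ⊤ := (hint (by simp)).2
    calc ∫⁻ x in K, ‖deriv f x‖ₑ
        ≤ ∫⁻ x in (K \ Ioc (-(n : ℝ)) n) ∪ Ioc (-(n : ℝ)) n, ‖deriv f x‖ₑ :=
          lintegral_mono_set (by simp)
      _ ≤ _ := lintegral_union_le _ _ _
      _ < ⊤ := ENNReal.add_lt_top.2 ⟨htail.trans_lt (by simp), hcore⟩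
end

section
/- Let f : ℝ → ℝ be absolutely continuous on ℝ. Then its almost-everywhere derivative f' belongs to L¹_G(ℝ): for every Lebesgue measurable set S ⊆ ℝ with finite Lebesgue measure, ∫_S |f'| dμ < ∞. -/
open MeasureTheory Set Filter
open scoped ENNReal

/-- The disjoint-intervals estimate extended from `Fin n` to arbitrary finite index sets. -/
theorem AbsolutelyContinuousOn.exists_forall_finset_sum_lt {f : ℝ → ℝ} {I : Set ℝ}
    (hf : AbsolutelyContinuousOn f I) {ε : ℝ} (hε : 0 < ε) :
    ∃ δ : ℝ, 0 < δ ∧ ∀ {ι : Type} (s : Finset ι) (a b : ι → ℝ),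
      (∀ i ∈ s, a i ∈ I ∧ b i ∈ I ∧ a i ≤ b i) →
      (s : Set ι).PairwiseDisjoint (fun i => Ioo (a i) (b i)) →
      ∑ i ∈ s, (b i - a i) < δ →
      ∑ i ∈ s, |f (b i) - f (a i)| < ε := by
  obtain ⟨δ, hδ, h⟩ := hf ε hε
  refine ⟨δ, hδ, fun {ι} s a b hab hdisj hsum => ?_⟩
  have key : ∀ F : ι → ℝ, ∑ i, F (s.equivFin.symm i) = ∑ i ∈ s, F i := fun F => by
    rw [Equiv.sum_comp s.equivFin.symm (fun i : s => F i), Finset.sum_coe_sort s F]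
  rw [← key] at hsum ⊢
  refine h s.card (fun i => a (s.equivFin.symm i)) (fun i => b (s.equivFin.symm i))
    (fun i => hab _ (s.equivFin.symm i).2) (fun i j hij => ?_) hsum
  exact hdisj (s.equivFin.symm i).2 (s.equivFin.symm j).2
    (fun e => hij (s.equivFin.symm.injective (Subtype.ext e)))

/-- Slopes over shrinking intervals `[a n, b n]` around `x` converge to the derivative at `x`. -/
theorem HasDerivAt.tendsto_straddle_slope {f : ℝ → ℝ} {f' x : ℝ} (hf : HasDerivAt f f' x)
    {a b : ℕ → ℝ} (ha : ∀ n, a n ≤ x) (hb : ∀ n, x ≤ b n) (hab : ∀ n, a n < b n)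
    (hlim : Tendsto (fun n => b n - a n) atTop (nhds 0)) :
    Tendsto (fun n => (b n - a n)⁻¹ * (f (b n) - f (a n))) atTop (nhds f') := by
  rw [Metric.tendsto_atTop]
  intro ε hε
  have ho := (hasDerivAt_iff_isLittleO.mp hf).def (half_pos hε)
  obtain ⟨r, hr, hball⟩ := Metric.eventually_nhds_iff.mp ho
  obtain ⟨n₀, hn₀⟩ := Metric.tendsto_atTop.mp hlim r hr
  refine ⟨n₀, fun n hn => ?_⟩
  have hpos : 0 < b n - a n := sub_pos.mpr (hab n)
  have hlt : b n - a n < r := by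
    have := hn₀ n hn
    rwa [Real.dist_eq, sub_zero, abs_of_pos hpos] at this
  have h1 := hball (y := a n) (by rw [Real.dist_eq, abs_lt]; constructor <;> linarith [ha n, hb n])
  have h2 := hball (y := b n) (by rw [Real.dist_eq, abs_lt]; constructor <;> linarith [ha n, hb n])
  rw [Real.norm_eq_abs, Real.norm_eq_abs, smul_eq_mul,
    abs_of_nonpos (by linarith [ha n] : a n - x ≤ 0),
    abs_le] at h1
  rw [Real.norm_eq_abs, Real.norm_eq_abs, smul_eq_mul,
    abs_of_nonneg (by linarith [hb n] : 0 ≤ b n - x),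
    abs_le] at h2
  have heq : (b n - a n)⁻¹ * (f (b n) - f (a n)) - f'
      = (f (b n) - f (a n) - (b n - a n) * f') / (b n - a n) := by
    field_simp
  rw [Real.dist_eq, heq, abs_div, abs_of_pos hpos, div_lt_iff₀ hpos, abs_lt]
  have : 0 < ε * (b n - a n) := by positivity
  constructor <;> nlinarith

/-- The set of points whose `c`-scaled integer part is `k` is a half-open interval. -/
theorem floor_mul_preimage_singleton {c : ℝ} (hc : 0 < c) (k : ℤ) :
    (fun x : ℝ => ⌊x * c⌋) ⁻¹' {k} = Ico (k / c) ((k + 1) / c) := by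
  ext x
  simp [Int.floor_eq_iff, div_le_iff₀ hc, lt_div_iff₀ hc]

theorem pairwise_disjoint_Ico_div {c : ℝ} (hc : 0 < c) :
    Pairwise fun j k : ℤ =>
      Disjoint (Ico ((j : ℝ) / c) ((j + 1) / c)) (Ico ((k : ℝ) / c) ((k + 1) / c)) := by
  intro j k hjk
  rw [← floor_mul_preimage_singleton hc, ← floor_mul_preimage_singleton hc]
  exact Disjoint.preimage _ (by simpa using hjk)

open Classical in
/-- The absolute slope of `f` over the grid cell `[k / c, (k + 1) / c]`, set to zero unless the
cell lies in `U`. -/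
noncomputable def gridSlope (f : ℝ → ℝ) (U : Set ℝ) (c : ℝ) (k : ℤ) : ℝ≥0∞ :=
  if Icc (k / c) ((k + 1) / c) ⊆ U then ‖c * (f ((k + 1) / c) - f (k / c))‖ₑ else 0

theorem lintegral_gridSlope (f : ℝ → ℝ) (U : Set ℝ) {c : ℝ} (hc : 0 < c) :
    ∫⁻ x, gridSlope f U c ⌊x * c⌋ = ∑' k : ℤ, gridSlope f U c k * ENNReal.ofReal c⁻¹ := by
  have hm : Measurable fun x : ℝ => ⌊x * c⌋ := (measurable_id.mul_const c).floor
  rw [← lintegral_map (f := gridSlope f U c) measurable_from_top hm, lintegral_countable']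
  refine tsum_congr fun k => ?_
  rw [Measure.map_apply hm (measurableSet_singleton k), floor_mul_preimage_singleton hc,
    Real.volume_Ico]
  congr 2
  field_simp
  ring

theorem enorm_deriv_le_liminf_gridSlope (f : ℝ → ℝ) {U : Set ℝ} (hU : IsOpen U) {x : ℝ}
    (hx : x ∈ U) :
    ‖deriv f x‖ₑ ≤ liminf (fun n : ℕ => gridSlope f U (n + 1) ⌊x * (n + 1)⌋) atTop := by
  by_cases hd : DifferentiableAt ℝ f x
  swap
  · simp [deriv_zero_of_not_differentiableAt hd]
  set a : ℕ → ℝ := fun n => ⌊x * (n + 1)⌋ / ((n : ℝ) + 1) with ha_def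
  set b : ℕ → ℝ := fun n => (⌊x * (n + 1)⌋ + 1) / ((n : ℝ) + 1) with hb_def
  have hc : ∀ n : ℕ, (0 : ℝ) < n + 1 := fun n => by positivity
  have ha : ∀ n, a n ≤ x := fun n => (div_le_iff₀ (hc n)).mpr (Int.floor_le _)
  have hb : ∀ n, x < b n := fun n => (lt_div_iff₀ (hc n)).mpr (Int.lt_floor_add_one _)
  have hsub : ∀ n, b n - a n = 1 / ((n : ℝ) + 1) := fun n => by
    simp only [ha_def, hb_def]; ring
  have hlim : Tendsto (fun n => b n - a n) atTop (nhds 0) := by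
    simp_rw [hsub]; exact tendsto_one_div_add_atTop_nhds_zero_nat
  have hslope := (hd.hasDerivAt.tendsto_straddle_slope ha (fun n => (hb n).le)
    (fun n => (ha n).trans_lt (hb n)) hlim).enorm
  rw [← hslope.liminf_eq]
  refine liminf_le_liminf ?_
  obtain ⟨r, hr, hball⟩ := Metric.isOpen_iff.mp hU x hx
  filter_upwards [hlim.eventually_lt_const hr] with n hn
  have hcell : Icc (a n) (b n) ⊆ U := fun y hy => hball <| by
    rw [Metric.mem_ball, Real.dist_eq, abs_lt]
    constructor <;> linarith [ha n, hb n, hy.1, hy.2]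
  rw [gridSlope, if_pos hcell, hsub, one_div, inv_inv]

theorem sum_sub_lt_of_Ico_subset {ι : Type*} {U : Set ℝ} {δ : ℝ}
    (hUδ : volume U < ENNReal.ofReal δ) (s : Finset ι) {a b : ι → ℝ} (hab : ∀ i ∈ s, a i ≤ b i)
    (hdisj : (s : Set ι).PairwiseDisjoint fun i => Ico (a i) (b i))
    (hsub : ∀ i ∈ s, Ico (a i) (b i) ⊆ U) : ∑ i ∈ s, (b i - a i) < δ := by
  have h : ENNReal.ofReal (∑ i ∈ s, (b i - a i)) ≤ volume U := by
    rw [ENNReal.ofReal_sum_of_nonneg fun i hi => sub_nonneg.mpr (hab i hi)]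
    simp_rw [← Real.volume_Ico]
    rw [← measure_biUnion_finset hdisj fun i _ => measurableSet_Ico]
    exact measure_mono (iUnion₂_subset hsub)
  exact (ENNReal.ofReal_lt_ofReal_iff'.mp (h.trans_lt hUδ)).1

/-- The integral of the absolute derivative of an absolutely continuous function is small over open
sets of small measure. -/
theorem AbsolutelyContinuousOn.exists_lintegral_enorm_deriv_le {f : ℝ → ℝ}
    (hf : AbsolutelyContinuousOn f univ) {ε : ℝ} (hε : 0 < ε) :
    ∃ δ : ℝ, 0 < δ ∧ ∀ U : Set ℝ, IsOpen U → volume U < ENNReal.ofReal δ →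
      ∫⁻ x in U, ‖deriv f x‖ₑ ≤ ENNReal.ofReal ε := by
  classical
  obtain ⟨δ, hδ, h⟩ := hf.exists_forall_finset_sum_lt hε
  refine ⟨δ, hδ, fun U hU hUδ => ?_⟩
  have hgrid : ∀ n : ℕ, ∫⁻ x : ℝ, gridSlope f U (n + 1) ⌊x * (n + 1)⌋ ≤ ENNReal.ofReal ε := by
    intro n
    have hc : (0 : ℝ) < n + 1 := by positivity
    generalize (n : ℝ) + 1 = c at hc ⊢
    rw [lintegral_gridSlope f U hc]
    refine ENNReal.summable.tsum_le_of_sum_le fun s => ?_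
    have hterm : ∀ k : ℤ, gridSlope f U c k * ENNReal.ofReal c⁻¹
        = if Icc (k / c) ((k + 1) / c) ⊆ U
          then ENNReal.ofReal |f ((k + 1) / c) - f (k / c)| else 0 := by
      intro k
      rw [gridSlope]
      split_ifs with hk
      · rw [Real.enorm_eq_ofReal_abs, ← ENNReal.ofReal_mul (abs_nonneg _), abs_mul,
          abs_of_pos hc]
        congr 1
        field_simp
      · simp
    simp_rw [hterm]
    rw [← Finset.sum_filter, ← ENNReal.ofReal_sum_of_nonneg fun _ _ => abs_nonneg _]
    have hle : ∀ k : ℤ, (k : ℝ) / c ≤ (k + 1) / c := fun k => by gcongr; linarith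
    have hdisj := pairwise_disjoint_Ico_div hc
    refine ENNReal.ofReal_le_ofReal (h _ (fun k : ℤ => (k : ℝ) / c) (fun k => (k + 1) / c)
      (fun k _ => ⟨mem_univ _, mem_univ _, hle k⟩)
      (fun j _ k _ hjk => (hdisj hjk).mono Ioo_subset_Ico_self Ioo_subset_Ico_self)
      (sum_sub_lt_of_Ico_subset hUδ _ (fun k _ => hle k) (hdisj.set_pairwise _) ?_)).le
    exact fun k hk => Ico_subset_Icc_self.trans (Finset.mem_filter.mp hk).2
  calc ∫⁻ x in U, ‖deriv f x‖ₑ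
      ≤ ∫⁻ x in U, liminf (fun n : ℕ => gridSlope f U (n + 1) ⌊x * (n + 1)⌋) atTop :=
        setLIntegral_mono' hU.measurableSet fun x hx => enorm_deriv_le_liminf_gridSlope f hU hx
    _ ≤ ∫⁻ x : ℝ, liminf (fun n : ℕ => gridSlope f U (n + 1) ⌊x * (n + 1)⌋) atTop :=
        setLIntegral_le_lintegral _ _
    _ ≤ liminf (fun n : ℕ => ∫⁻ x : ℝ, gridSlope f U (n + 1) ⌊x * (n + 1)⌋) atTop :=
        lintegral_liminf_le fun n =>
          (measurable_from_top (f := gridSlope f U (n + 1))).comp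
            (measurable_id.mul_const ((n : ℝ) + 1)).floor
    _ ≤ ENNReal.ofReal ε :=
        (liminf_le_liminf (Eventually.of_forall hgrid)).trans_eq (liminf_const _)

/-- If `f` is absolutely continuous on `ℝ` then its a.e. derivative belongs to `L¹_G(ℝ)`:
it is integrable over every measurable set of finite Lebesgue measure. -/
theorem deriv_mem_L1G_of_absolutelyContinuous
    (f : ℝ → ℝ)
    (hAC : AbsolutelyContinuousOn f univ) :
    ∀ S : Set ℝ, MeasurableSet S → volume S < ⊤ →
      ∫⁻ x in S, ‖deriv f x‖₊ ∂volume < ⊤ := by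
  intro S hS hfin
  obtain ⟨δ, hδ, h⟩ := hAC.exists_lintegral_enorm_deriv_le one_pos
  have hsmall : ∀ T : Set ℝ, volume T < ENNReal.ofReal δ → ∫⁻ x in T, ‖deriv f x‖ₑ < ⊤ := by
    intro T hT
    obtain ⟨U, hTU, hU, hUδ⟩ := T.exists_isOpen_lt_of_lt _ hT
    exact ((lintegral_mono_set hTU).trans (h U hU hUδ)).trans_lt ENNReal.ofReal_lt_top
  have htail : Tendsto (fun n : ℕ => volume (S \ Metric.closedBall (0 : ℝ) n)) atTop (nhds 0) := by
    have hempty : ⋂ n : ℕ, S \ Metric.closedBall (0 : ℝ) n = ∅ := by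
      rw [← sdiff_iUnion, Metric.iUnion_closedBall_nat, sdiff_univ]
    rw [← measure_empty (μ := (volume : Measure ℝ)), ← hempty]
    refine tendsto_measure_iInter_atTop
      (fun n => (hS.diff measurableSet_closedBall).nullMeasurableSet) (fun m n hmn => ?_)
      ⟨0, ((measure_mono sdiff_subset).trans_lt hfin).ne⟩
    exact sdiff_subset_sdiff_right (Metric.closedBall_subset_closedBall (by exact_mod_cast hmn))
  obtain ⟨n, hn⟩ := (htail.eventually_lt_const (ENNReal.ofReal_pos.mpr hδ)).exists
  have hball : ∫⁻ x in Metric.closedBall (0 : ℝ) n, ‖deriv f x‖ₑ < ⊤ := by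
    rw [← withDensity_apply _ measurableSet_closedBall]
    refine (isCompact_closedBall _ _).measure_lt_top_of_nhdsWithin fun x _ => ?_
    refine ⟨Metric.ball x (δ / 3),
      mem_nhdsWithin_of_mem_nhds (Metric.ball_mem_nhds _ (by positivity)), ?_⟩
    rw [withDensity_apply _ measurableSet_ball]
    refine hsmall _ ?_
    rw [Real.volume_ball]
    exact (ENNReal.ofReal_lt_ofReal_iff hδ).mpr (by linarith)
  calc ∫⁻ x in S, ‖deriv f x‖ₑ
      ≤ ∫⁻ x in (S \ Metric.closedBall (0 : ℝ) n) ∪ Metric.closedBall (0 : ℝ) n, ‖deriv f x‖ₑ :=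
        lintegral_mono_set (by rw [sdiff_union_self]; exact subset_union_left)
    _ ≤ _ := lintegral_union_le _ _ _
    _ < ⊤ := ENNReal.add_lt_top.mpr ⟨hsmall _ hn, hball⟩
end

section
/- Let I ⊆ ℝ be an interval and let f : I → ℝ be a measurable function such that ∫_K |f| dμ < ∞ for every Lebesgue measurable subset K ⊆ I of finite Lebesgue measure. Then there exists M > 0 such that μ{x ∈ I : |f(x)| ≥ M} < ∞. (Theorem 2: L¹_G(I) ⊆ L¹_H(I).) -/
open MeasureTheory Set Filter
open scoped ENNReal

/-- The Lebesgue measure of the part of a set lying in `[-r, r]` depends continuously on `r`. -/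
theorem continuous_volume_real_inter_Icc (A : Set ℝ) :
    Continuous fun r : ℝ => volume.real (A ∩ Icc (-r) r) := by
  refine (LipschitzWith.of_le_add_mul 2 fun s r => ?_).continuous
  have hsub : A ∩ Icc (-s) s ⊆ (A ∩ Icc (-r) r) ∪ (Icc (-s) (-r) ∪ Icc r s) := by
    rintro x ⟨hxA, hx₁, hx₂⟩
    by_cases h₁ : x < -r
    · exact Or.inr (Or.inl ⟨hx₁, h₁.le⟩)
    · by_cases h₂ : r < x
      · exact Or.inr (Or.inr ⟨h₂.le, hx₂⟩)
      · exact Or.inl ⟨hxA, not_lt.1 h₁, not_lt.1 h₂⟩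
  have hfin (a b : ℝ) : volume (A ∩ Icc a b) ≠ ⊤ :=
    measure_ne_top_of_subset inter_subset_right measure_Icc_lt_top.ne
  have hfin' : volume (Icc (-s) (-r) ∪ Icc r s) ≠ ⊤ :=
    (measure_union_lt_top measure_Icc_lt_top measure_Icc_lt_top).ne
  have h₁ := measureReal_mono hsub (measure_union_ne_top (hfin _ _) hfin')
  have h₂ := measureReal_union_le (μ := volume) (A ∩ Icc (-r) r) (Icc (-s) (-r) ∪ Icc r s)
  have h₃ := measureReal_union_le (μ := volume) (Icc (-s) (-r)) (Icc r s)
  have h₄ : max (s - r) 0 ≤ dist s r := max_le (le_abs_self _) dist_nonneg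
  rw [Real.volume_real_Icc, Real.volume_real_Icc, show -r - -s = s - r by ring] at h₃
  push_cast
  linarith

/-- A measurable set of infinite Lebesgue measure has measurable subsets of every finite measure. -/
theorem exists_measurable_subset_volume_eq {A : Set ℝ} (hA : MeasurableSet A)
    (hA_top : volume A = ⊤) {c : ℝ} (hc : 0 ≤ c) :
    ∃ t ⊆ A, MeasurableSet t ∧ volume t = ENNReal.ofReal c := by
  have hlim : Tendsto (fun n : ℕ => volume (A ∩ Icc (-(n : ℝ)) n)) atTop (nhds ⊤) := by
    have hmono : Monotone fun n : ℕ => A ∩ Icc (-(n : ℝ)) n := fun m n hmn =>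
      inter_subset_inter_right _ (Icc_subset_Icc (by gcongr) (by gcongr))
    have hunion : ⋃ n : ℕ, A ∩ Icc (-(n : ℝ)) n = A := by
      rw [← inter_iUnion, inter_eq_left]
      intro x _
      obtain ⟨n, hn⟩ := exists_nat_ge |x|
      exact mem_iUnion.2 ⟨n, abs_le.1 hn⟩
    simpa only [hunion, hA_top, Function.comp_def] using
      tendsto_measure_iUnion_atTop (μ := volume) hmono
  obtain ⟨n, hn⟩ := (hlim.eventually_const_lt (ENNReal.ofReal_lt_top (r := c))).exists
  have hfin (r : ℝ) : volume (A ∩ Icc (-r) r) ≠ ⊤ :=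
    measure_ne_top_of_subset inter_subset_right measure_Icc_lt_top.ne
  have h₀ : volume.real (A ∩ Icc (-(0 : ℝ)) 0) = 0 := by
    rw [measureReal_def, measure_mono_null inter_subset_right (by simp), ENNReal.toReal_zero]
  obtain ⟨r, -, hr⟩ := intermediate_value_Icc (Nat.cast_nonneg (α := ℝ) n)
    (continuous_volume_real_inter_Icc A).continuousOn
    ⟨h₀.trans_le hc, (ENNReal.ofReal_le_iff_le_toReal (hfin n)).1 hn.le⟩
  refine ⟨A ∩ Icc (-r) r, inter_subset_left, hA.inter measurableSet_Icc, ?_⟩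
  rw [← hr, ofReal_measureReal (hfin r)]

/-- Theorem 2: `L¹_G(I) ⊆ L¹_H(I)`. If a measurable `f` is integrable over every measurable
subset of an interval `I` of finite measure, then there is `M > 0` with
`μ {x ∈ I | |f x| ≥ M} < ∞`. -/
theorem L1G_subset_L1H
    (I : Set ℝ) (hI : I.OrdConnected)
    (f : ℝ → ℝ) (hf : Measurable f)
    (hG : ∀ K : Set ℝ, K ⊆ I → MeasurableSet K → volume K < ⊤ →
      ∫⁻ x in K, ‖f x‖₊ ∂volume < ⊤) :
    ∃ M : ℝ, 0 < M ∧ volume {x ∈ I | M ≤ |f x|} < ⊤ := by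
  by_contra! h
  have hmeas (M : ℝ) : MeasurableSet {x ∈ I | M ≤ |f x|} :=
    hI.measurableSet.inter (measurableSet_le measurable_const hf.abs)
  choose t ht_sub ht_meas ht_vol using fun n : ℕ =>
    exists_measurable_subset_volume_eq (hmeas (4 ^ n)) (top_le_iff.1 (h (4 ^ n) (by positivity)))
      (c := (1 / 2) ^ n) (by positivity)
  have hK_vol : volume (⋃ n, t n) < ⊤ := by
    refine (measure_iUnion_le t).trans_lt ?_
    simp_rw [ht_vol]
    rw [← ENNReal.ofReal_tsum_of_nonneg (fun n => by positivity) summable_geometric_two]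
    exact ENNReal.ofReal_lt_top
  have hK_int := hG _ (iUnion_subset fun n x hx => (ht_sub n hx).1)
    (MeasurableSet.iUnion ht_meas) hK_vol
  have hlower (n : ℕ) : ENNReal.ofReal (2 ^ n) ≤ ∫⁻ x in ⋃ n, t n, ‖f x‖₊ :=
    calc ENNReal.ofReal (2 ^ n) = ENNReal.ofReal (4 ^ n) * volume (t n) := by
          rw [ht_vol, ← ENNReal.ofReal_mul (by positivity), ← mul_pow]
          norm_num
      _ = ∫⁻ _ in t n, ENNReal.ofReal (4 ^ n) := (setLIntegral_const _ _).symm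
      _ ≤ ∫⁻ x in t n, ‖f x‖₊ := by
          refine setLIntegral_mono' (ht_meas n) fun x hx => ?_
          rw [← enorm_eq_nnnorm, ← ofReal_norm]
          exact ENNReal.ofReal_le_ofReal (ht_sub n hx).2
      _ ≤ ∫⁻ x in ⋃ n, t n, ‖f x‖₊ := lintegral_mono_set (subset_iUnion t n)
  obtain ⟨n, hn⟩ := pow_unbounded_of_one_lt (∫⁻ x in ⋃ n, t n, ‖f x‖₊).toReal one_lt_two
  exact hn.not_ge ((ENNReal.ofReal_le_iff_le_toReal hK_int.ne).1 (hlower n))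
end

section
/- Let f : ℝ → ℝ be a measurable function such that for every M > 0 the set {x ∈ ℝ : |f(x)| ≥ M} has infinite Lebesgue measure. Then there exists a Lebesgue measurable set G ⊆ ℝ with μ(G) < ∞ such that ∫_G |f| dμ = ∞. -/
open MeasureTheory Set Filter
open scoped ENNReal

/-- Lebesgue measure on the line takes on measurable subsets of `A` every value below the measure
of `A`. -/
theorem exists_measurableSet_subset_volume_eq {A : Set ℝ} (hA : MeasurableSet A) {c : ℝ≥0∞}
    (hc : c < volume A) : ∃ B ⊆ A, MeasurableSet B ∧ volume B = c := by
  set g : ℝ → ℝ≥0∞ := fun t => volume (A ∩ Icc (-t) t)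
  have hcont : Continuous g := by
    refine continuous_of_le_add_edist 2 (by simp) fun t s => ?_
    have hsub : A ∩ Icc (-t) t ⊆ (A ∩ Icc (-s) s) ∪ (Icc s t ∪ Icc (-t) (-s)) := by
      rintro x ⟨hxA, hx₁, hx₂⟩
      rcases le_total x s with h₁ | h₁
      · rcases le_total (-s) x with h₂ | h₂
        · exact Or.inl ⟨hxA, h₂, h₁⟩
        · exact Or.inr (Or.inr ⟨hx₁, h₂⟩)
      · exact Or.inr (Or.inl ⟨h₁, hx₂⟩)
    have hlen : ENNReal.ofReal (t - s) ≤ edist t s := by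
      rw [edist_dist, Real.dist_eq]
      exact ENNReal.ofReal_le_ofReal (le_abs_self _)
    calc g t ≤ g s + (volume (Icc s t) + volume (Icc (-t) (-s))) :=
          (measure_mono hsub).trans <|
            (measure_union_le _ _).trans (add_le_add_right (measure_union_le _ _) _)
      _ ≤ g s + 2 * edist t s := by
          rw [Real.volume_Icc, Real.volume_Icc, neg_sub_neg, two_mul]
          gcongr
  have hzero : g 0 = 0 := measure_mono_null inter_subset_right (by simp)
  obtain ⟨n, hn⟩ : ∃ n : ℕ, c < g n := by
    have hmono : Monotone fun n : ℕ => A ∩ Icc (-(n : ℝ)) n := fun m n hmn =>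
      inter_subset_inter_right _ (Icc_subset_Icc (by gcongr) (by gcongr))
    have hunion : ⋃ n : ℕ, A ∩ Icc (-(n : ℝ)) n = A := by
      rw [← inter_iUnion, inter_eq_left]
      intro x _
      obtain ⟨n, hn⟩ := exists_nat_ge |x|
      exact mem_iUnion.2 ⟨n, abs_le.1 hn⟩
    rw [← hunion, hmono.measure_iUnion] at hc
    exact lt_iSup_iff.1 hc
  obtain ⟨t, ht⟩ := mem_range_of_exists_le_of_exists_ge hcont ⟨0, by simp [hzero]⟩ ⟨n, hn.le⟩
  exact ⟨A ∩ Icc (-t) t, inter_subset_left, hA.inter measurableSet_Icc, ht⟩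

/-- Contrapositive form of `L¹_G(ℝ) ⊆ L¹_H(ℝ)`: if for every `M > 0` the set
`{x | |f x| ≥ M}` has infinite measure, then there is a measurable set `G` of finite measure
over which `|f|` has infinite integral. -/
theorem exists_finite_measure_set_with_infinite_integral
    (f : ℝ → ℝ) (hf : Measurable f)
    (h : ∀ M : ℝ, 0 < M → volume {x : ℝ | M ≤ |f x|} = ⊤) :
    ∃ G : Set ℝ, MeasurableSet G ∧ volume G < ⊤ ∧
      ∫⁻ x in G, ‖f x‖₊ ∂volume = ⊤ := by
  have hsub : ∀ n : ℕ, ∃ B ⊆ {x : ℝ | (4 : ℝ) ^ n ≤ |f x|},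
      MeasurableSet B ∧ volume B = 2⁻¹ ^ n := fun n =>
    exists_measurableSet_subset_volume_eq (measurableSet_le measurable_const hf.abs)
      (by rw [h _ (by positivity)]; exact ENNReal.pow_lt_top (by simp))
  choose B hBf hBm hBv using hsub
  refine ⟨⋃ n, B n, MeasurableSet.iUnion hBm, ?_, ?_⟩
  · calc volume (⋃ n, B n) ≤ ∑' n, volume (B n) := measure_iUnion_le _
      _ = 2 := by simp_rw [hBv]; exact ENNReal.tsum_geometric_two
      _ < ⊤ := by simp
  · have hle : ∀ n : ℕ, (2 : ℝ≥0∞) ^ n ≤ ∫⁻ x in ⋃ n, B n, ‖f x‖₊ := fun n =>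
      calc (2 : ℝ≥0∞) ^ n = 4 ^ n * volume (B n) := by
            rw [hBv, ← mul_pow, show (4 : ℝ≥0∞) = 2 * 2 by norm_num, mul_assoc,
              ENNReal.mul_inv_cancel (by simp) (by simp), mul_one]
        _ = ∫⁻ _ in B n, 4 ^ n := (setLIntegral_const _ _).symm
        _ ≤ ∫⁻ x in B n, ‖f x‖₊ := by
            refine setLIntegral_mono' (hBm n) fun x hx => ?_
            have hx' : (4 : NNReal) ^ n ≤ ‖f x‖₊ := by
              rw [← NNReal.coe_le_coe]
              simpa using hBf n hx
            exact_mod_cast hx'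
        _ ≤ ∫⁻ x in ⋃ n, B n, ‖f x‖₊ := lintegral_mono_set (subset_iUnion B n)
    exact top_unique <|
      le_of_tendsto' (ENNReal.tendsto_pow_atTop_nhds_top_iff.2 (by norm_num)) hle
end

section
/- Let f : ℝ → ℝ be the 2-periodic function determined by f(x) = √|x| for −1 ≤ x ≤ 1 and f(x + 2k) = f(x) for all k ∈ ℤ, and let f' denote its almost-everywhere derivative. Let A = ⋃_{n=1}^∞ [2n, 2n + 1/n²]. Then A has finite Lebesgue measure but ∫_A |f'| dμ = ∞; hence f' ∉ L¹_G(ℝ). -/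
open MeasureTheory Set Filter
open scoped ENNReal

theorem hasDerivAt_periodic_sqrt {f : ℝ → ℝ}
    (hf : ∀ x ∈ Icc (-1 : ℝ) 1, f x = Real.sqrt |x|)
    (hper : ∀ (x : ℝ) (k : ℤ), f (x + 2 * k) = f x) (k : ℤ) {x : ℝ}
    (hx : x ∈ Ioo (2 * (k : ℝ)) (2 * k + 1)) :
    HasDerivAt f (1 / (2 * Real.sqrt (x - 2 * k))) x := by
  have hlocal : f =ᶠ[nhds x] fun y => Real.sqrt (y - 2 * k) := by
    filter_upwards [Ioo_mem_nhds hx.1 hx.2] with y hy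
    have hshift := hper (y - 2 * k) k
    rw [sub_add_cancel] at hshift
    rw [hshift, hf _ ⟨by linarith [hy.1], by linarith [hy.2]⟩,
      abs_of_pos (by linarith [hy.1])]
  exact (((hasDerivAt_id x).sub_const (2 * (k : ℝ))).sqrt
    (sub_pos.2 hx.1).ne').congr_of_eventuallyEq hlocal

theorem half_le_nnnorm_deriv_periodic_sqrt {f : ℝ → ℝ}
    (hf : ∀ x ∈ Icc (-1 : ℝ) 1, f x = Real.sqrt |x|)
    (hper : ∀ (x : ℝ) (k : ℤ), f (x + 2 * k) = f x) (k : ℤ) {m : ℝ} (hm : 1 ≤ m) {x : ℝ}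
    (hx : x ∈ Ioo (2 * (k : ℝ)) (2 * k + 1 / m ^ 2)) :
    ENNReal.ofReal (m / 2) ≤ ‖deriv f x‖₊ := by
  have hm0 : 0 < m := by linarith
  have hle : 1 / m ^ 2 ≤ 1 := by
    rw [div_le_one (by positivity)]
    nlinarith
  rw [(hasDerivAt_periodic_sqrt hf hper k ⟨hx.1, by linarith [hx.2]⟩).deriv,
    ← enorm_eq_nnnorm, Real.enorm_eq_ofReal (by positivity)]
  apply ENNReal.ofReal_le_ofReal
  have hpos : 0 < Real.sqrt (x - 2 * k) := Real.sqrt_pos.2 (sub_pos.2 hx.1)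
  have hsqrt : Real.sqrt (x - 2 * k) ≤ 1 / m := by
    rw [Real.sqrt_le_left (by positivity), div_pow, one_pow]
    linarith [hx.2]
  rw [le_div_iff₀ hm0] at hsqrt
  rw [le_div_iff₀ (by positivity)]
  linarith

theorem tsum_ofReal_eq_top_of_not_summable {a : ℕ → ℝ} (ha : ∀ n, 0 ≤ a n)
    (h : ¬ Summable a) : ∑' n, ENNReal.ofReal (a n) = ⊤ := by
  by_contra hne
  refine h ((ENNReal.summable_toReal hne).congr fun n => ?_)
  exact ENNReal.toReal_ofReal (ha n)

/-- For the 2-periodic function given by `f x = √|x|` on `[-1, 1]`, the set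
`A = ⋃_{n ≥ 1} [2n, 2n + 1/n²]` has finite measure but `∫_A |f'| = ∞`;
hence `f' ∉ L¹_G(ℝ)`. -/
theorem periodic_sqrt_deriv_not_L1G
    (f : ℝ → ℝ)
    (hf : ∀ x ∈ Icc (-1 : ℝ) 1, f x = Real.sqrt |x|)
    (hper : ∀ (x : ℝ) (k : ℤ), f (x + 2 * k) = f x) :
    volume (⋃ n : ℕ, Icc (2 * ((n : ℝ) + 1)) (2 * ((n : ℝ) + 1) + 1 / ((n : ℝ) + 1) ^ 2)) < ⊤ ∧
    ∫⁻ x in ⋃ n : ℕ, Icc (2 * ((n : ℝ) + 1)) (2 * ((n : ℝ) + 1) + 1 / ((n : ℝ) + 1) ^ 2),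
      ‖deriv f x‖₊ ∂volume = ⊤ := by
  constructor
  · refine (measure_iUnion_le _).trans_lt ?_
    simp only [Real.volume_Icc, add_sub_cancel_left]
    have hsum : Summable fun n : ℕ => 1 / ((n : ℝ) + 1) ^ 2 := by
      have := (summable_nat_add_iff 1).2 (Real.summable_one_div_nat_pow.2 one_lt_two)
      simpa only [Nat.cast_add, Nat.cast_one] using this
    exact hsum.tsum_ofReal_lt_top
  · set I : ℕ → Set ℝ := fun n =>
      Ioo (2 * ((n : ℝ) + 1)) (2 * ((n : ℝ) + 1) + 1 / ((n : ℝ) + 1) ^ 2) with hI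
    have hlen (n : ℕ) : 1 / ((n : ℝ) + 1) ^ 2 ≤ 1 := by
      rw [div_le_one (by positivity)]
      nlinarith [n.cast_nonneg (α := ℝ)]
    have hdisj : Pairwise (Function.onFun Disjoint I) := by
      refine (pairwise_disjoint_on I).2 fun i j hij => Set.disjoint_left.2 fun x hi hj => ?_
      have hij' : (i : ℝ) + 1 ≤ j := by exact_mod_cast hij
      linarith [hi.2, hj.1, hlen i]
    have hterm (n : ℕ) :
        ENNReal.ofReal (1 / 2 * (1 / ((n : ℝ) + 1))) ≤ ∫⁻ x in I n, ‖deriv f x‖₊ := by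
      have hn : (0 : ℝ) < n + 1 := by positivity
      calc
        _ = ∫⁻ _ in I n, ENNReal.ofReal (((n : ℝ) + 1) / 2) := by
          rw [setLIntegral_const, hI, Real.volume_Ioo, add_sub_cancel_left,
            ← ENNReal.ofReal_mul (by positivity)]
          congr 1
          field_simp
        _ ≤ _ := by
          refine setLIntegral_mono' measurableSet_Ioo fun x hx => ?_
          refine half_le_nnnorm_deriv_periodic_sqrt hf hper ((n : ℤ) + 1)
            (by linarith [n.cast_nonneg (α := ℝ)]) ?_
          push_cast
          exact hx
    have hharm : ¬ Summable fun n : ℕ => 1 / 2 * (1 / ((n : ℝ) + 1)) := by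
      rw [summable_mul_left_iff (by norm_num)]
      have := mt (summable_nat_add_iff 1).1 Real.not_summable_one_div_natCast
      simpa only [Nat.cast_add, Nat.cast_one] using this
    refine top_unique ?_
    calc
      ⊤ = ∑' n : ℕ, ENNReal.ofReal (1 / 2 * (1 / ((n : ℝ) + 1))) :=
        (tsum_ofReal_eq_top_of_not_summable (fun n => by positivity) hharm).symm
      _ ≤ ∑' n, ∫⁻ x in I n, ‖deriv f x‖₊ := ENNReal.tsum_le_tsum hterm
      _ = ∫⁻ x in ⋃ n, I n, ‖deriv f x‖₊ :=
        (lintegral_iUnion (fun _ => measurableSet_Ioo) hdisj _).symm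
      _ ≤ _ := lintegral_mono_set (iUnion_mono fun _ => Ioo_subset_Icc_self)
end

section
/- The function f₂ : ℝ → ℝ defined by f₂ = Σ_{n=1}^∞ n · χ_{[n, n + 1/n²]} (and f₂ = 0 elsewhere) is locally integrable and belongs to L¹_H(ℝ) (the set {x : |f₂(x)| ≥ 1} = ⋃_{n=1}^∞ [n, n + 1/n²] has measure Σ 1/n² < ∞), but does not belong to L¹_G(ℝ): the set G = ⋃_{n=1}^∞ [n, n + 1/n²] has finite Lebesgue measure, yet ∫_G |f₂| dμ ≥ Σ_{n=1}^∞ n · (1/n²) = Σ_{n=1}^∞ 1/n = ∞. -/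
open MeasureTheory Set Filter
open scoped ENNReal

/-- `f₂ = ∑_{n=1}^∞ n · χ_{[n, n + 1/n²]}`. -/
noncomputable def f₂ : ℝ → ℝ := fun x =>
  ∑' n : ℕ, Set.indicator (Icc ((n : ℝ) + 1) (((n : ℝ) + 1) + 1 / ((n : ℝ) + 1) ^ 2))
    (fun _ => ((n : ℝ) + 1)) x

/-- The `n`-th interval `[n + 1, n + 1 + 1 / (n + 1)²]` supporting a summand of `f₂`. -/
def f₂Interval (n : ℕ) : Set ℝ :=
  Icc ((n : ℝ) + 1) (((n : ℝ) + 1) + 1 / ((n : ℝ) + 1) ^ 2)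

/-- The `n`-th summand of `f₂`. -/
noncomputable def f₂Term (n : ℕ) : ℝ → ℝ :=
  (f₂Interval n).indicator fun _ => (n : ℝ) + 1

lemma f₂_eq_tsum (x : ℝ) : f₂ x = ∑' n, f₂Term n x := rfl

lemma measurableSet_f₂Interval (n : ℕ) : MeasurableSet (f₂Interval n) := measurableSet_Icc

lemma measurable_f₂Term (n : ℕ) : Measurable (f₂Term n) :=
  measurable_const.indicator (measurableSet_f₂Interval n)

lemma volume_f₂Interval (n : ℕ) :
    volume (f₂Interval n) = ENNReal.ofReal (1 / ((n : ℝ) + 1) ^ 2) := by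
  simp [f₂Interval, Real.volume_Icc]

lemma f₂Term_nonneg (n : ℕ) (x : ℝ) : 0 ≤ f₂Term n x :=
  indicator_nonneg (fun _ _ => by positivity) x

lemma f₂Term_eq_zero {n N : ℕ} {x : ℝ} (hx : x < N) (hn : N ≤ n) : f₂Term n x = 0 := by
  refine indicator_of_notMem (fun h => ?_) _
  have h1 : (n : ℝ) + 1 ≤ x := h.1
  have h2 : (N : ℝ) ≤ n := by exact_mod_cast hn
  linarith

lemma summable_f₂Term (x : ℝ) : Summable fun n => f₂Term n x := by
  obtain ⟨N, hN⟩ := exists_nat_gt x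
  exact summable_of_ne_finset_zero (s := Finset.range N) fun n hn =>
    f₂Term_eq_zero hN (by simpa using hn)

lemma f₂_eq_sum_range {N : ℕ} {x : ℝ} (hx : x < N) :
    f₂ x = ∑ n ∈ Finset.range N, f₂Term n x :=
  tsum_eq_sum fun _ hn => f₂Term_eq_zero hx (by simpa using hn)

lemma f₂_nonneg (x : ℝ) : 0 ≤ f₂ x := tsum_nonneg fun n => f₂Term_nonneg n x

lemma integrable_f₂Term (n : ℕ) : Integrable (f₂Term n) :=
  (integrable_indicator_iff (measurableSet_f₂Interval n)).2
    (integrableOn_const (by simp [volume_f₂Interval]))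

lemma locallyIntegrable_f₂ : LocallyIntegrable f₂ volume := by
  intro x
  obtain ⟨N, hN⟩ := exists_nat_gt x
  refine ⟨Iio (N : ℝ), Iio_mem_nhds hN, ?_⟩
  refine IntegrableOn.congr_fun (f := fun y => ∑ n ∈ Finset.range N, f₂Term n y)
    ?_ (fun y hy => (f₂_eq_sum_range hy).symm) measurableSet_Iio
  exact (integrable_finsetSum _ fun n _ => integrable_f₂Term n).integrableOn

lemma volume_iUnion_f₂Interval_lt_top : volume (⋃ n, f₂Interval n) < ⊤ := by
  refine (measure_iUnion_le _).trans_lt ?_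
  have hs : Summable fun n : ℕ => 1 / ((n : ℝ) + 1) ^ 2 := by
    simpa using (summable_nat_add_iff 1).2 (Real.summable_one_div_nat_pow.2 one_lt_two)
  simp_rw [volume_f₂Interval]
  exact hs.tsum_ofReal_lt_top

lemma setOf_one_le_abs_f₂_subset : {x : ℝ | 1 ≤ |f₂ x|} ⊆ ⋃ n, f₂Interval n := by
  intro x hx
  by_contra h
  simp only [mem_iUnion, not_exists] at h
  have h0 : f₂ x = 0 := by
    simp [f₂_eq_tsum, f₂Term, h]
  norm_num [h0] at hx

lemma setLIntegral_f₂Term (n : ℕ) :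
    ∫⁻ x in ⋃ n, f₂Interval n, ENNReal.ofReal (f₂Term n x) =
      ENNReal.ofReal (1 / ((n : ℝ) + 1)) := by
  have h : (fun x => ENNReal.ofReal (f₂Term n x)) =
      (f₂Interval n).indicator fun _ => ENNReal.ofReal ((n : ℝ) + 1) := by
    ext x
    by_cases hx : x ∈ f₂Interval n <;> simp [f₂Term, hx]
  rw [h, setLIntegral_indicator (measurableSet_f₂Interval n),
    inter_eq_left.2 (subset_iUnion f₂Interval n), setLIntegral_const, volume_f₂Interval,
    ← ENNReal.ofReal_mul (by positivity)]
  congr 1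
  field_simp

lemma setLIntegral_f₂_eq_top : ∫⁻ x in ⋃ n, f₂Interval n, ‖f₂ x‖₊ = ⊤ := by
  have h (x : ℝ) : (‖f₂ x‖₊ : ℝ≥0∞) = ∑' n, ENNReal.ofReal (f₂Term n x) := by
    rw [← ENNReal.ofReal_tsum_of_nonneg (fun n => f₂Term_nonneg n x) (summable_f₂Term x),
      ← f₂_eq_tsum]
    exact Real.enorm_of_nonneg (f₂_nonneg x)
  simp_rw [h]
  rw [lintegral_tsum fun n => (measurable_f₂Term n).ennreal_ofReal.aemeasurable]
  simp_rw [setLIntegral_f₂Term]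
  by_contra hne
  have hs := ENNReal.summable_toReal hne
  have hs' : Summable fun n : ℕ => 1 / ((n : ℝ) + 1) :=
    hs.congr fun n => ENNReal.toReal_ofReal (by positivity)
  refine Real.not_summable_one_div_natCast ((summable_nat_add_iff 1).1 ?_)
  simpa using hs'

/-- `f₂` is locally integrable and belongs to `L¹_H(ℝ)` (the set `{x | |f₂ x| ≥ 1}` has
finite measure), but `f₂ ∉ L¹_G(ℝ)`: the set `G = ⋃_{n ≥ 1} [n, n + 1/n²]` has finite
Lebesgue measure while `∫_G |f₂| = ∞`. -/
theorem f2_locallyIntegrable_L1H_not_L1G :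
    MeasureTheory.LocallyIntegrable f₂ volume ∧
    volume {x : ℝ | 1 ≤ |f₂ x|} < ⊤ ∧
    volume (⋃ n : ℕ, Icc ((n : ℝ) + 1) (((n : ℝ) + 1) + 1 / ((n : ℝ) + 1) ^ 2)) < ⊤ ∧
    ∫⁻ x in ⋃ n : ℕ, Icc ((n : ℝ) + 1) (((n : ℝ) + 1) + 1 / ((n : ℝ) + 1) ^ 2),
      ‖f₂ x‖₊ ∂volume = ⊤ :=
  ⟨locallyIntegrable_f₂,
    (measure_mono setOf_one_le_abs_f₂_subset).trans_lt volume_iUnion_f₂Interval_lt_top,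
    volume_iUnion_f₂Interval_lt_top, setLIntegral_f₂_eq_top⟩
end
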